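/- Let Q be an indexed set of polynomials of degree at most k on n pairs of twin variables, and let w be a positive integer. If d is the minimum degree and s is the minimum monomial size of PS refutations from Q of product-width at most w (such refutations existing), and d ≥ k·w + 4, then s ≥ exp((d − k·w − 4)² / (32·(n+1))). -/

import Mathlib

open MvPolynomial

noncomputable section

/-- The polynomial ring in `n` pairs of twin variables: `Sum.inl i` is the basic
variable `xᵢ` and `Sum.inr i` is its twin `x̄ᵢ`. -/
abbrev MvPoly (n : ℕ) : Type := MvPolynomial (Fin n ⊕ Fin n) ℝ

/-- The Boolean axioms `xᵢ² − xᵢ`, `x̄ᵢ² − x̄ᵢ` and `xᵢ + x̄ᵢ − 1`. -/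
def boolAxiom (n : ℕ) (a : Fin 3 × Fin n) : MvPoly n :=
  if a.1 = 0 then X (Sum.inl a.2) ^ 2 - X (Sum.inl a.2)
  else if a.1 = 1 then X (Sum.inr a.2) ^ 2 - X (Sum.inr a.2)
  else X (Sum.inl a.2) + X (Sum.inr a.2) - 1

/-- The sum of squares of a list of polynomials. -/
def sosOf {n : ℕ} (l : List (MvPoly n)) : MvPoly n := (l.map (· ^ 2)).sum

/-- A Positivstellensatz proof of `goal ≥ 0` from the inequality constraints
`q j ≥ 0` (`j : Fin ℓ`) and the equality constraints `p j = 0` (`j : Fin m`),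
on `n` pairs of twin variables. -/
structure PSProof (n ℓ m : ℕ) (q : Fin ℓ → MvPoly n) (p : Fin m → MvPoly n)
    (goal : MvPoly n) : Type where
  Js : Finset (Finset (Fin ℓ))
  empty_not_mem : ∅ ∉ Js
  r0 : List (MvPoly n)
  r : Finset (Fin ℓ) → List (MvPoly n)
  t : Fin m → MvPoly n
  u : Fin 3 × Fin n → MvPoly n
  identity : goal = sosOf r0 + ∑ J ∈ Js, sosOf (r J) * ∏ j ∈ J, q j
      + ∑ j, t j * p j + ∑ a, u a * boolAxiom n a

namespace PSProof

variable {n ℓ m : ℕ} {q : Fin ℓ → MvPoly n} {p : Fin m → MvPoly n} {goal : MvPoly n}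

/-- The proof has product-width at most `w`. -/
def widthLE (π : PSProof n ℓ m q p goal) (w : ℕ) : Prop := ∀ J ∈ π.Js, J.card ≤ w

/-- The proof has degree at most `d` (the zero polynomial having degree `−∞`). -/
def degreeLE (π : PSProof n ℓ m q p goal) (d : ℕ) : Prop :=
  goal.totalDegree ≤ d ∧ (sosOf π.r0).totalDegree ≤ d ∧
  (∀ J ∈ π.Js, sosOf (π.r J) ≠ 0 →
    (sosOf (π.r J)).totalDegree + ∑ j ∈ J, (q j).totalDegree ≤ d) ∧
  (∀ j, π.t j ≠ 0 → (π.t j).totalDegree + (p j).totalDegree ≤ d)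

/-- The monomial size of the proof: the total number of monomials of the `r` and `t`
polynomials. -/
def size (π : PSProof n ℓ m q p goal) : ℕ :=
  (π.r0.map fun r => r.support.card).sum
  + ∑ J ∈ π.Js, ((π.r J).map fun r => r.support.card).sum
  + ∑ j, (π.t j).support.card

end PSProof

namespace PSAux

/-- Real functions on the Boolean cube. -/
abbrev Fn (n : ℕ) : Type := (Fin n → Bool) → ℝ

/-- Literals. -/
abbrev Lit (n : ℕ) : Type := Fin n ⊕ Fin n

/-- The value of a literal. -/
def lit {n : ℕ} (l : Lit n) : Fn n := fun x =>
  match l with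
  | Sum.inl i => if x i then 1 else 0
  | Sum.inr i => if x i then 0 else 1

/-- Set a literal to true. -/
def setT {n : ℕ} (l : Lit n) (x : Fin n → Bool) : Fin n → Bool :=
  match l with
  | Sum.inl i => Function.update x i true
  | Sum.inr i => Function.update x i false

lemma lit_mul_self {n : ℕ} (l : Lit n) : lit l * lit l = lit l := by
  ext x
  rcases l with i | i <;> simp [lit]

lemma lit_setT_self {n : ℕ} (l : Lit n) (x : Fin n → Bool) : lit l (setT l x) = 1 := by
  rcases l with i | i <;> simp [lit, setT]

lemma lit_swap_setT {n : ℕ} (l : Lit n) (x : Fin n → Bool) : lit l.swap (setT l x) = 0 := by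
  rcases l with i | i <;> simp [lit, setT]

lemma lit_setT_ne {n : ℕ} (l m : Lit n) (h1 : m ≠ l) (h2 : m ≠ l.swap) (x : Fin n → Bool) :
    lit m (setT l x) = lit m x := by
  rcases l with i | i <;> rcases m with j | j <;>
    simp_all [lit, setT, Function.update_apply]

lemma lit_mul_setT {n : ℕ} (l : Lit n) (x : Fin n → Bool) (f : Fn n) :
    lit l x * f (setT l x) = lit l x * f x := by
  rcases l with i | i
  · by_cases h : x i = true
    · have : setT (Sum.inl i) x = x := by simp [setT, ← h]
      rw [this]
    · simp [lit, h]
  · by_cases h : x i = true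
    · simp [lit, h]
    · have h' : x i = false := by simpa using h
      have : setT (Sum.inr i) x = x := by simp [setT, ← h']
      rw [this]

lemma lit_add_swap {n : ℕ} (l : Lit n) (x : Fin n → Bool) : lit l x + lit l.swap x = 1 := by
  rcases l with i | i <;> by_cases h : x i = true <;> simp [lit, h]

/-- Product of a set of literals. -/
def mono {n : ℕ} (A : Finset (Lit n)) : Fn n := ∏ l ∈ A, lit l

lemma mono_mul {n : ℕ} (A B : Finset (Lit n)) : mono A * mono B = mono (A ∪ B) := by
  classical
  have key : ∀ (l : Lit n) (B : Finset (Lit n)), lit l * mono B = mono (insert l B) := by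
    intro l B
    by_cases h : l ∈ B
    · rw [Finset.insert_eq_of_mem h, mono, ← Finset.mul_prod_erase B _ h, ← mul_assoc,
        lit_mul_self]
    · rw [mono, mono, Finset.prod_insert h]
  induction A using Finset.induction_on with
  | empty => simp [mono]
  | insert a s ha ih =>
    rw [← key a s, mul_assoc, ih, key, Finset.insert_union]

lemma mono_sq {n : ℕ} (A : Finset (Lit n)) : mono A * mono A = mono A := by
  rw [mono_mul, Finset.union_idempotent]

lemma mono_empty {n : ℕ} : mono (∅ : Finset (Lit n)) = 1 := by simp [mono]

lemma mono_singleton {n : ℕ} (l : Lit n) : mono {l} = lit l := by simp [mono]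

lemma mono_setT {n : ℕ} (A : Finset (Lit n)) (l : Lit n) (x : Fin n → Bool) :
    mono A (setT l x) = if l.swap ∈ A then 0 else mono (A.erase l) x := by
  split_ifs with h
  · rw [mono, Finset.prod_apply]
    exact Finset.prod_eq_zero h (lit_swap_setT l x)
  · rw [mono, mono, Finset.prod_apply, Finset.prod_apply]
    have e : ∏ c ∈ A.erase l, lit c (setT l x) = ∏ c ∈ A, lit c (setT l x) := by
      apply Finset.prod_subset (Finset.erase_subset _ _)
      intro y hy hy'
      have : y = l := by
        by_contra hne
        exact hy' (Finset.mem_erase.2 ⟨hne, hy⟩)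
      rw [this, lit_setT_self]
    rw [← e]
    apply Finset.prod_congr rfl
    intro y hy
    rw [Finset.mem_erase] at hy
    apply lit_setT_ne _ _ hy.1
    rintro rfl
    exact h hy.2

/-- Functions of degree at most `N`. -/
def V (n N : ℕ) : Submodule ℝ (Fn n) :=
  Submodule.span ℝ {f | ∃ A : Finset (Lit n), A.card ≤ N ∧ f = mono A}

/-- Functions spanned by a set of monomials. -/
def SM {n : ℕ} (M : Finset (Finset (Lit n))) : Submodule ℝ (Fn n) :=
  Submodule.span ℝ {f | ∃ A ∈ M, f = mono A}

lemma mono_mem_V {n N : ℕ} {A : Finset (Lit n)} (h : A.card ≤ N) : mono A ∈ V n N :=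
  Submodule.subset_span ⟨A, h, rfl⟩

lemma one_mem_V {n N : ℕ} : (1 : Fn n) ∈ V n N := by
  rw [← mono_empty]; exact mono_mem_V (by simp)

lemma lit_mem_V {n : ℕ} (l : Lit n) : lit l ∈ V n 1 := by
  rw [← mono_singleton]; exact mono_mem_V (by simp)

lemma V_mono {n a b : ℕ} (h : a ≤ b) : V n a ≤ V n b := by
  apply Submodule.span_mono
  rintro f ⟨A, hA, rfl⟩
  exact ⟨A, hA.trans h, rfl⟩

lemma V_mul {n a b : ℕ} {f g : Fn n} (hf : f ∈ V n a) (hg : g ∈ V n b) : f * g ∈ V n (a + b) := by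
  have h := Submodule.mul_mem_mul hf hg
  rw [V, V, Submodule.span_mul_span] at h
  refine Submodule.span_mono ?_ h
  rintro _ ⟨_, ⟨A, hA, rfl⟩, _, ⟨B, hB, rfl⟩, rfl⟩
  exact ⟨A ∪ B, (Finset.card_union_le _ _).trans (by omega), mono_mul A B⟩

lemma V_prod {n k : ℕ} {ι : Type*} (J : Finset ι) (q : ι → Fn n) (hq : ∀ j, q j ∈ V n k) :
    ∏ j ∈ J, q j ∈ V n (k * J.card) := by
  classical
  induction J using Finset.induction_on with
  | empty => simpa using one_mem_V
  | insert a s ha ih =>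
    rw [Finset.prod_insert ha, Finset.card_insert_of_notMem ha]
    have := V_mul (hq a) ih
    refine V_mono ?_ this
    rw [mul_add]; omega

/-- Composition with a restriction, as a linear map. -/
def comp {n : ℕ} (l : Lit n) : Fn n →ₗ[ℝ] Fn n where
  toFun f := fun x => f (setT l x)
  map_add' _ _ := rfl
  map_smul' _ _ := rfl

lemma comp_apply {n : ℕ} (l : Lit n) (f : Fn n) (x) : comp l f x = f (setT l x) := rfl

lemma comp_mul {n : ℕ} (l : Lit n) (f g : Fn n) : comp l (f * g) = comp l f * comp l g := rfl

lemma comp_prod {n : ℕ} {ι : Type*} (l : Lit n) (J : Finset ι) (q : ι → Fn n) :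
    comp l (∏ j ∈ J, q j) = ∏ j ∈ J, comp l (q j) := by
  ext x
  simp [comp_apply, Finset.prod_apply]

lemma lit_mul_comp {n : ℕ} (l : Lit n) (f : Fn n) : lit l * comp l f = lit l * f := by
  ext x
  exact lit_mul_setT l x f

lemma comp_mono {n : ℕ} (l : Lit n) (A : Finset (Lit n)) :
    comp l (mono A) = if l.swap ∈ A then 0 else mono (A.erase l) := by
  ext x
  rw [comp_apply, mono_setT]
  split_ifs <;> rfl

lemma comp_mem_V {n N : ℕ} (l : Lit n) {f : Fn n} (hf : f ∈ V n N) : comp l f ∈ V n N := by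
  have : V n N ≤ (V n N).comap (comp l) := by
    rw [V, Submodule.span_le]
    rintro _ ⟨A, hA, rfl⟩
    change comp l (mono A) ∈ V n N
    rw [comp_mono]
    split_ifs
    · exact zero_mem _
    · exact mono_mem_V ((Finset.card_le_card (Finset.erase_subset _ _)).trans hA)
  exact this hf

/-- Restrict a set of monomials. -/
def restr {n : ℕ} (l : Lit n) (M : Finset (Finset (Lit n))) : Finset (Finset (Lit n)) :=
  (M.filter (fun A => l.swap ∉ A)).image (fun A => A.erase l)

lemma comp_mem_SM {n : ℕ} (l : Lit n) (M : Finset (Finset (Lit n))) {f : Fn n} (hf : f ∈ SM M) :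
    comp l f ∈ SM (restr l M) := by
  have : SM M ≤ (SM (restr l M)).comap (comp l) := by
    rw [SM, Submodule.span_le]
    rintro _ ⟨A, hA, rfl⟩
    change comp l (mono A) ∈ SM (restr l M)
    rw [comp_mono]
    split_ifs with h
    · exact zero_mem _
    · refine Submodule.subset_span ⟨A.erase l, ?_, rfl⟩
      exact Finset.mem_image.2 ⟨A, Finset.mem_filter.2 ⟨hA, h⟩, rfl⟩
  exact this hf

/-- The cone of PS-provable functions. -/
def K {n ℓ m : ℕ} (q : Fin ℓ → Fn n) (p : Fin m → Fn n) (w : ℕ)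
    (U0 U1 U2 : Submodule ℝ (Fn n)) : AddSubmonoid (Fn n) :=
  AddSubmonoid.closure
    ({f | ∃ g ∈ U0, f = g * g} ∪
      ({f | ∃ g ∈ U1, ∃ J : Finset (Fin ℓ), J.card ≤ w ∧ J.Nonempty ∧ f = g * g * ∏ j ∈ J, q j} ∪
        {f | ∃ t ∈ U2, ∃ j, f = t * p j}))

section
variable {n ℓ m : ℕ} {q : Fin ℓ → Fn n} {p : Fin m → Fn n} {w : ℕ}
  {U0 U1 U2 : Submodule ℝ (Fn n)}

lemma K_sq {g : Fn n} (h : g ∈ U0) : g * g ∈ K q p w U0 U1 U2 :=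
  AddSubmonoid.subset_closure (Or.inl ⟨g, h, rfl⟩)

lemma K_q {g : Fn n} (h : g ∈ U1) {J : Finset (Fin ℓ)} (hJ : J.card ≤ w) (hJ' : J.Nonempty) :
    g * g * ∏ j ∈ J, q j ∈ K q p w U0 U1 U2 :=
  AddSubmonoid.subset_closure (Or.inr (Or.inl ⟨g, h, J, hJ, hJ', rfl⟩))

lemma K_p {t : Fn n} (h : t ∈ U2) (j : Fin m) : t * p j ∈ K q p w U0 U1 U2 :=
  AddSubmonoid.subset_closure (Or.inr (Or.inr ⟨t, h, j, rfl⟩))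

lemma K_ind {P : Fn n → Prop} (h0 : P 0) (hadd : ∀ f g, P f → P g → P (f + g))
    (hsq : ∀ g ∈ U0, P (g * g))
    (hJ : ∀ g ∈ U1, ∀ J : Finset (Fin ℓ), J.card ≤ w → J.Nonempty → P (g * g * ∏ j ∈ J, q j))
    (ht : ∀ t ∈ U2, ∀ j, P (t * p j)) {f : Fn n} (hf : f ∈ K q p w U0 U1 U2) : P f := by
  refine AddSubmonoid.closure_induction (motive := fun f _ => P f) ?_ h0 ?_ hf
  · rintro f (⟨g, hg, rfl⟩ | ⟨g, hg, J, h1, h2, rfl⟩ | ⟨t, ht', j, rfl⟩)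
    · exact hsq g hg
    · exact hJ g hg J h1 h2
    · exact ht t ht' j
  · intro f g _ _ hf hg
    exact hadd f g hf hg

lemma K_mono {W0 W1 W2 : Submodule ℝ (Fn n)} (h0 : U0 ≤ W0) (h1 : U1 ≤ W1) (h2 : U2 ≤ W2)
    {f : Fn n} (hf : f ∈ K q p w U0 U1 U2) : f ∈ K q p w W0 W1 W2 := by
  refine K_ind (P := fun f => f ∈ K q p w W0 W1 W2) (zero_mem _) (fun _ _ => add_mem) ?_ ?_ ?_ hf
  · intro g hg; exact K_sq (h0 hg)
  · intro g hg J a b; exact K_q (h1 hg) a b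
  · intro t ht j; exact K_p (h2 ht) j

lemma K_smul {c : ℝ} (hc : 0 ≤ c) {f : Fn n} (hf : f ∈ K q p w U0 U1 U2) :
    c • f ∈ K q p w U0 U1 U2 := by
  have e : ∀ g : Fn n, c • (g * g) = (Real.sqrt c • g) * (Real.sqrt c • g) := by
    intro g
    rw [smul_mul_smul_comm, Real.mul_self_sqrt hc]
  refine K_ind (P := fun f => c • f ∈ K q p w U0 U1 U2) ?_ ?_ ?_ ?_ ?_ hf
  · rw [smul_zero]; exact zero_mem _
  · intro f g hf hg; rw [smul_add]; exact add_mem hf hg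
  · intro g hg; rw [e]; exact K_sq (U0.smul_mem _ hg)
  · intro g hg J a b; rw [← smul_mul_assoc, e]; exact K_q (U1.smul_mem _ hg) a b
  · intro t ht j; rw [← smul_mul_assoc]; exact K_p (U2.smul_mem _ ht) j

lemma K_restr (M : Finset (Finset (Lit n))) (l : Lit n) {f : Fn n}
    (hf : f ∈ K q p w (SM M) (SM M) (SM M)) :
    comp l f ∈ K (fun j => comp l (q j)) (fun j => comp l (p j)) w
      (SM (restr l M)) (SM (restr l M)) (SM (restr l M)) := by
  refine K_ind (P := fun f => comp l f ∈ K (fun j => comp l (q j)) (fun j => comp l (p j)) w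
      (SM (restr l M)) (SM (restr l M)) (SM (restr l M))) ?_ ?_ ?_ ?_ ?_ hf
  · rw [map_zero]; exact zero_mem _
  · intro f g hf hg; rw [map_add]; exact add_mem hf hg
  · intro g hg; exact K_sq (comp_mem_SM l M hg)
  · intro g hg J a b; rw [comp_mul, comp_prod]; exact K_q (comp_mem_SM l M hg) a b
  · intro t ht j; exact K_p (comp_mem_SM l M ht) j

/-- The degree-`e` cone. -/
def KD (q : Fin ℓ → Fn n) (p : Fin m → Fn n) (w c e : ℕ) : AddSubmonoid (Fn n) :=
  K q p w (V n (e + c)) (V n e) (V n (2 * e))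

lemma KD_lift (l : Lit n) {c e : ℕ} {f : Fn n}
    (hf : f ∈ KD (fun j => comp l (q j)) (fun j => comp l (p j)) w c e) :
    lit l * f ∈ KD q p w c (e + 1) := by
  have hl := lit_mul_self l
  refine K_ind (P := fun f => lit l * f ∈ KD q p w c (e + 1)) ?_ ?_ ?_ ?_ ?_ hf
  · rw [mul_zero]; exact zero_mem _
  · intro f g hf hg; rw [mul_add]; exact add_mem hf hg
  · intro g hg
    have : lit l * (g * g) = (g * lit l) * (g * lit l) := by
      rw [mul_mul_mul_comm, hl, mul_comm]
    rw [this]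
    exact K_sq (V_mono (by omega) (V_mul hg (lit_mem_V l)))
  · intro g hg J a b
    have : lit l * (g * g * ∏ j ∈ J, comp l (q j)) =
        (g * lit l) * (g * lit l) * ∏ j ∈ J, q j := by
      rw [mul_mul_mul_comm, hl, mul_left_comm, ← comp_prod, lit_mul_comp, mul_assoc (g * g)]
    rw [this]
    exact K_q (V_mono (by omega) (V_mul hg (lit_mem_V l))) a b
  · intro t ht j
    have : lit l * (t * comp l (p j)) = (t * lit l) * p j := by
      rw [mul_left_comm, lit_mul_comp, mul_assoc]
    rw [this]
    exact K_p (V_mono (by omega) (V_mul ht (lit_mem_V l))) j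

lemma KD_diff (l : Lit n) {c e k N : ℕ} (hq : ∀ j, q j ∈ V n k) (hp : ∀ j, p j ∈ V n k)
    (hN : 2 * e + k * w ≤ N) (hw : 0 < w) {f : Fn n}
    (hf : f ∈ KD (fun j => comp l (q j)) (fun j => comp l (p j)) w c e) :
    ∃ g ∈ KD q p w c e, ∃ h ∈ V n N, f = g + lit l.swap * h := by
  have key : ∀ a : Fn n, comp l a = a + lit l.swap * (comp l a - a) := by
    intro a
    ext x
    have h1 := lit_add_swap l x
    have h2 := congrFun (lit_mul_comp l a) x
    simp only [Pi.add_apply, Pi.mul_apply, Pi.sub_apply] at *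
    have : lit l.swap x = 1 - lit l x := by linarith
    rw [this]
    linear_combination h2
  refine K_ind (P := fun f => ∃ g ∈ KD q p w c e, ∃ h ∈ V n N, f = g + lit l.swap * h)
    ?_ ?_ ?_ ?_ ?_ hf
  · exact ⟨0, zero_mem _, 0, zero_mem _, by simp⟩
  · rintro f g ⟨a, ha, b, hb, rfl⟩ ⟨a', ha', b', hb', rfl⟩
    exact ⟨a + a', add_mem ha ha', b + b', add_mem hb hb', by ring⟩
  · intro g hg
    exact ⟨g * g, K_sq hg, 0, zero_mem _, by simp⟩
  · intro g hg J a b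
    refine ⟨g * g * ∏ j ∈ J, q j, K_q hg a b,
      g * g * (comp l (∏ j ∈ J, q j) - ∏ j ∈ J, q j), ?_, ?_⟩
    · have h1 := V_prod J q hq
      have hle : k * J.card ≤ k * w := Nat.mul_le_mul_left _ a
      exact V_mono (by omega) (V_mul (V_mul hg hg) (sub_mem (comp_mem_V l h1) h1))
    · rw [← comp_prod]
      conv_lhs => rw [key]
      ring
  · intro t ht j
    refine ⟨t * p j, K_p ht j, t * (comp l (p j) - p j), ?_, ?_⟩
    · have hle : k * 1 ≤ k * w := Nat.mul_le_mul_left _ hw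
      exact V_mono (by omega) (V_mul ht (sub_mem (comp_mem_V l (hp j)) (hp j)))
    · conv_lhs => rw [key (p j)]
      ring

lemma KD_one {c e : ℕ} : (1 : Fn n) ∈ KD q p w c e := by
  have : (1 : Fn n) = 1 * 1 := by simp
  rw [this]
  exact K_sq one_mem_V

lemma KD_eps (l : Lit n) {c e N : ℕ} (hN : N + 1 ≤ 2 * (e + c))
    (hl : - lit l ∈ KD q p w c e) {h : Fn n} (hh : h ∈ V n N) :
    ∀ ε : ℝ, 0 < ε → (ε • (1 : Fn n) + lit l * h ∈ KD q p w c e ∧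
      ε • (1 : Fn n) - lit l * h ∈ KD q p w c e) := by
  refine Submodule.span_induction (p := fun h _ => ∀ ε : ℝ, 0 < ε →
    (ε • (1 : Fn n) + lit l * h ∈ KD q p w c e ∧ ε • (1 : Fn n) - lit l * h ∈ KD q p w c e))
    ?_ ?_ ?_ ?_ hh
  · rintro _ ⟨A, hA, rfl⟩ ε hε
    obtain ⟨B, hBA, hB⟩ := Finset.exists_subset_card_eq
      (show min A.card (e + c) ≤ A.card from min_le_left _ _)
    have hv : mono B ∈ V n (e + c) := mono_mem_V (by omega)
    have hu' : mono (A \ B) ∈ V n (e + c - 1) := mono_mem_V (by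
      rw [Finset.card_sdiff_of_subset hBA]; omega)
    have hAB : mono A = mono (A \ B) * mono B := by
      rw [mono_mul, Finset.sdiff_union_of_subset hBA]
    have hu1 := mono_sq (A \ B)
    have hv1 := mono_sq B
    have hl1 := lit_mul_self l
    generalize mono B = v at *
    generalize mono (A \ B) = u at *
    have hu : lit l * u ∈ V n (e + c) := V_mono (by omega) (V_mul (lit_mem_V l) hu')
    have hul : lit l * (1 - u) ∈ V n (e + c) :=
      V_mono (by omega) (V_mul (lit_mem_V l) (sub_mem one_mem_V hu'))
    have hv' : (1 - v) ∈ V n (e + c) := sub_mem one_mem_V hv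
    obtain ⟨δ, hδ, rfl⟩ : ∃ δ : ℝ, 0 < δ ∧ ε = δ ^ 2 :=
      ⟨Real.sqrt ε, Real.sqrt_pos.2 hε, (Real.sq_sqrt hε.le).symm⟩
    have main : ∀ s : ℝ, s ^ 2 = 1 →
        (δ ^ 2) • (1 : Fn n) + s • (lit l * mono A) ∈ KD q p w c e := by
      intro s hs
      have e1 : (δ ^ 2) • (1 : Fn n) + s • (lit l * mono A) =
          ((1 / (2 * δ)) • (lit l * u) + (s * δ) • v) * ((1 / (2 * δ)) • (lit l * u) + (s * δ) • v)
          + (δ ^ 2) • ((1 - v) * (1 - v))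
          + (1 / (4 * δ ^ 2)) • ((- lit l) + (lit l * (1 - u)) * (lit l * (1 - u))) := by
        rw [hAB]
        ext x
        have a1 := congrFun hu1 x
        have a2 := congrFun hv1 x
        have a3 := congrFun hl1 x
        simp only [Pi.add_apply, Pi.mul_apply, Pi.sub_apply, Pi.smul_apply, smul_eq_mul,
          Pi.one_apply, Pi.neg_apply] at *
        generalize lit l x = L at *
        generalize u x = a at *
        generalize v x = b at *
        have b1 : (L * (1 - a)) * (L * (1 - a)) = L - L * a := by
          linear_combination (1 - a) ^ 2 * a3 + L * a1
        have b2 : (1 / (2 * δ) * (L * a) + s * δ * b) * (1 / (2 * δ) * (L * a) + s * δ * b) =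
            (1 / (4 * δ ^ 2)) * (L * a) + s * (L * (a * b)) + δ ^ 2 * b := by
          have c1 : (1 / (2 * δ) * (L * a) + s * δ * b) * (1 / (2 * δ) * (L * a) + s * δ * b) =
            (1 / (4 * δ ^ 2)) * ((L * L) * (a * a)) + s * (L * (a * b))
              + s ^ 2 * δ ^ 2 * (b * b) := by
            field_simp
            ring
          rw [c1, a1, a2, a3, hs, one_mul]
        rw [b1, b2]
        linear_combination (-δ ^ 2) * a2
      rw [e1]
      refine add_mem (add_mem (K_sq (add_mem (Submodule.smul_mem _ _ hu)
        (Submodule.smul_mem _ _ hv))) (K_smul (by positivity) (K_sq hv')))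
        (K_smul (by positivity) (add_mem hl (K_sq hul)))
    constructor
    · simpa using main 1 (by norm_num)
    · simpa [sub_eq_add_neg] using main (-1) (by norm_num)
  · intro ε hε
    have := K_smul hε.le (KD_one (q := q) (p := p) (w := w) (c := c) (e := e))
    rw [mul_zero, add_zero, sub_zero]
    exact ⟨this, this⟩
  · intro x y _ _ hx hy ε hε
    obtain ⟨a1, a2⟩ := hx (ε / 2) (by positivity)
    obtain ⟨b1, b2⟩ := hy (ε / 2) (by positivity)
    have e0 : ε • (1 : Fn n) = (ε / 2) • (1 : Fn n) + (ε / 2) • (1 : Fn n) := by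
      rw [← add_smul, add_halves]
    constructor
    · convert add_mem a1 b1 using 1
      rw [e0]; ring
    · convert add_mem a2 b2 using 1
      rw [e0]; ring
  · intro a x _ hx ε hε
    have hpos : ∀ a : ℝ, 0 < a → ε • (1 : Fn n) + lit l * (a • x) ∈ KD q p w c e ∧
        ε • (1 : Fn n) - lit l * (a • x) ∈ KD q p w c e := by
      intro a ha
      obtain ⟨h1, h2⟩ := hx (ε / a) (by positivity)
      have h1' := K_smul ha.le h1
      have h2' := K_smul ha.le h2
      rw [smul_add, smul_smul, mul_div_cancel₀ _ ha.ne'] at h1'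
      rw [smul_sub, smul_smul, mul_div_cancel₀ _ ha.ne'] at h2'
      rw [mul_smul_comm]
      exact ⟨h1', h2'⟩
    rcases lt_trichotomy a 0 with ha | ha | ha
    · obtain ⟨h1, h2⟩ := hpos (-a) (by linarith)
      rw [neg_smul, mul_neg] at h1 h2
      rw [sub_neg_eq_add] at h2
      rw [← sub_eq_add_neg] at h1
      exact ⟨h2, h1⟩
    · subst ha
      have := K_smul hε.le (KD_one (q := q) (p := p) (w := w) (c := c) (e := e))
      rw [zero_smul, mul_zero, add_zero, sub_zero]
      exact ⟨this, this⟩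
    · exact hpos a ha

lemma combine (l : Lit n) {c e k : ℕ} (hq : ∀ j, q j ∈ V n k) (hp : ∀ j, p j ∈ V n k)
    (hw : 0 < w) (hc : k * w + 1 ≤ 2 * c)
    (h0 : (-1 : Fn n) ∈ KD (fun j => comp l.swap (q j)) (fun j => comp l.swap (p j)) w c e)
    (h1 : (-1 : Fn n) ∈ KD (fun j => comp l (q j)) (fun j => comp l (p j)) w c (e + 1)) :
    (-1 : Fn n) ∈ KD q p w c (e + 1) := by
  have h0' := KD_lift l.swap h0
  rw [mul_neg_one] at h0'
  obtain ⟨g, hg, h, hh, hgh⟩ := KD_diff l hq hp le_rfl hw h1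
  have := (KD_eps l.swap (by omega) h0' hh (1 / 2) (by norm_num)).1
  have h2 := K_smul (c := 2) (by norm_num) (add_mem hg this)
  have e1 : (-1 : Fn n) = (2 : ℝ) • (g + ((1 / 2 : ℝ) • (1 : Fn n) + lit l.swap * h)) := by
    ext x
    have := congrFun hgh x
    simp only [Pi.add_apply, Pi.mul_apply, Pi.smul_apply, smul_eq_mul,
          Pi.one_apply, Pi.neg_apply] at *
    linarith
  rw [e1]
  exact h2

end

/-- The fat monomials. -/
def fat {n : ℕ} (T : ℕ) (M : Finset (Finset (Lit n))) : Finset (Finset (Lit n)) :=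
  M.filter (fun A => T < A.card)

lemma fat_restr {n : ℕ} (T : ℕ) (l : Lit n) (M : Finset (Finset (Lit n))) :
    (fat T (restr l M)).card ≤ ((fat T M).filter (fun A => l.swap ∉ A)).card := by
  have : fat T (restr l M) ⊆
      ((fat T M).filter (fun A => l.swap ∉ A)).image (fun A => A.erase l) := by
    intro B hB
    simp only [fat, restr, Finset.mem_filter, Finset.mem_image] at hB ⊢
    obtain ⟨⟨A, ⟨hA, hA'⟩, rfl⟩, hT⟩ := hB
    exact ⟨A, ⟨⟨hA, hT.trans_le (Finset.card_le_card (Finset.erase_subset _ _))⟩, hA'⟩, rfl⟩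
  exact (Finset.card_le_card this).trans Finset.card_image_le

lemma sup_restr {n : ℕ} (l : Lit n) (M : Finset (Finset (Lit n)))
    (h : l ∈ M.sup id ∨ l.swap ∈ M.sup id) :
    ((restr l M).sup id).card < (M.sup id).card := by
  apply Finset.card_lt_card
  have h1 : (restr l M).sup id ⊆ M.sup id := by
    intro x hx
    rw [Finset.mem_sup] at hx ⊢
    obtain ⟨B, hB, hx⟩ := hx
    simp only [restr, Finset.mem_filter, Finset.mem_image] at hB
    obtain ⟨A, ⟨hA, _⟩, rfl⟩ := hB
    exact ⟨A, hA, Finset.mem_of_mem_erase hx⟩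
  have h2 : l ∉ (restr l M).sup id := by
    intro hx
    rw [Finset.mem_sup] at hx
    obtain ⟨B, hB, hx⟩ := hx
    simp only [restr, Finset.mem_filter, Finset.mem_image] at hB
    obtain ⟨A, ⟨hA, _⟩, rfl⟩ := hB
    simp at hx
  have h3 : l.swap ∉ (restr l M).sup id := by
    intro hx
    rw [Finset.mem_sup] at hx
    obtain ⟨B, hB, hx⟩ := hx
    simp only [restr, Finset.mem_filter, Finset.mem_image] at hB
    obtain ⟨A, ⟨hA, hA'⟩, rfl⟩ := hB
    exact hA' (Finset.mem_of_mem_erase hx)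
  rcases h with h | h
  · exact Finset.ssubset_iff_of_subset h1 |>.2 ⟨_, h, h2⟩
  · exact Finset.ssubset_iff_of_subset h1 |>.2 ⟨_, h, h3⟩

lemma popular {n T : ℕ} (M : Finset (Finset (Lit n))) (hM : (fat T M).Nonempty) :
    ∃ l : Lit n, l ∈ M.sup id ∧
      ((T : ℝ) + 1) / (2 * (n + 1)) * (fat T M).card ≤
        ((fat T M).filter (fun A => l ∈ A)).card := by
  by_contra hcon
  push Not at hcon
  have hcount : ∑ A ∈ fat T M, A.card =
      ∑ l : Lit n, ((fat T M).filter (fun A => l ∈ A)).card := by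
    have := Finset.sum_card_bipartiteAbove_eq_sum_card_bipartiteBelow
      (s := fat T M) (t := (Finset.univ : Finset (Lit n))) (fun A l => l ∈ A)
    simp only [Finset.bipartiteAbove, Finset.bipartiteBelow] at this
    simpa using this
  have hb : (0 : ℝ) < (fat T M).card := by exact_mod_cast hM.card_pos
  have hlow : ((T : ℝ) + 1) * (fat T M).card ≤ ∑ A ∈ fat T M, (A.card : ℝ) := by
    rw [mul_comm, ← nsmul_eq_mul]
    apply Finset.card_nsmul_le_sum
    intro A hA
    simp only [fat, Finset.mem_filter] at hA
    exact_mod_cast hA.2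
  have hup : ∀ l : Lit n, (((fat T M).filter (fun A => l ∈ A)).card : ℝ) ≤
      ((T : ℝ) + 1) / (2 * (n + 1)) * (fat T M).card := by
    intro l
    by_cases hl : l ∈ M.sup id
    · exact (hcon l hl).le
    · have : (fat T M).filter (fun A => l ∈ A) = ∅ := by
        rw [Finset.filter_eq_empty_iff]
        intro A hA hlA
        exact hl (Finset.mem_sup.2 ⟨A, (Finset.mem_filter.1 hA).1, hlA⟩)
      rw [this]
      simp only [Finset.card_empty, Nat.cast_zero]
      positivity
  have hsum : (∑ A ∈ fat T M, (A.card : ℝ)) ≤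
      (2 * n : ℝ) * (((T : ℝ) + 1) / (2 * (n + 1)) * (fat T M).card) := by
    have : (∑ A ∈ fat T M, (A.card : ℝ)) =
        ∑ l : Lit n, (((fat T M).filter (fun A => l ∈ A)).card : ℝ) := by exact_mod_cast hcount
    rw [this]
    refine (Finset.sum_le_card_nsmul _ _ _ (fun l _ => hup l)).trans (le_of_eq ?_)
    simp
    left
    ring
  have : (2 * n : ℝ) * (((T : ℝ) + 1) / (2 * (n + 1)) * (fat T M).card)
      < ((T : ℝ) + 1) * (fat T M).card := by
    have hT : (0 : ℝ) < ((T : ℝ) + 1) * (fat T M).card := by positivity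
    have e : (2 * n : ℝ) * (((T : ℝ) + 1) / (2 * (n + 1)) * (fat T M).card) =
      (n / (n + 1)) * (((T : ℝ) + 1) * (fat T M).card) := by
      field_simp
    rw [e]
    have : (n : ℝ) / (n + 1) < 1 := by
      rw [div_lt_one (by positivity)]; linarith
    nlinarith
  linarith

lemma base_case {n ℓ m w c T a : ℕ} {q : Fin ℓ → Fn n} {p : Fin m → Fn n}
    {M : Finset (Finset (Lit n))} (hf : fat T M = ∅)
    (hM : (-1 : Fn n) ∈ K q p w (SM M) (SM M) (SM M)) : (-1 : Fn n) ∈ KD q p w c (T + a) := by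
  have h : SM M ≤ V n T := by
    apply Submodule.span_mono
    rintro f ⟨A, hA, rfl⟩
    refine ⟨A, ?_, rfl⟩
    by_contra hcon
    have : A ∈ fat T M := Finset.mem_filter.2 ⟨hA, by omega⟩
    rw [hf] at this
    simp at this
  exact K_mono (h.trans (V_mono (by omega))) (h.trans (V_mono (by omega)))
    (h.trans (V_mono (by omega))) hM

lemma main_induction {n ℓ m k w c T : ℕ} (hw : 0 < w) (hc : k * w + 1 ≤ 2 * c) :
    ∀ (v a : ℕ) (q : Fin ℓ → Fn n) (p : Fin m → Fn n) (M : Finset (Finset (Lit n))),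
      (∀ j, q j ∈ V n k) → (∀ j, p j ∈ V n k) → (M.sup id).card ≤ v →
      ((fat T M).card : ℝ) < Real.exp (((T : ℝ) + 1) / (2 * (n + 1)) * a) →
      (-1 : Fn n) ∈ K q p w (SM M) (SM M) (SM M) → (-1 : Fn n) ∈ KD q p w c (T + a) := by
  intro v
  induction v with
  | zero =>
    intro a q p M hq hp hv hb hM
    apply base_case _ hM
    rw [Finset.eq_empty_iff_forall_notMem]
    intro A hA
    obtain ⟨hA, hT⟩ := Finset.mem_filter.1 hA
    have h1 : A ⊆ M.sup id := Finset.le_sup (f := id) hA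
    have := Finset.card_le_card h1
    omega
  | succ v ih =>
    intro a q p M hq hp hv hb hM
    rcases (fat T M).eq_empty_or_nonempty with hf | hf
    · exact base_case hf hM
    obtain ⟨l, hl, hpop⟩ := popular M hf
    have hpos : (1 : ℝ) ≤ (fat T M).card := by exact_mod_cast hf.card_pos
    obtain _ | a := a
    · simp at hb
      exact absurd hf.ne_empty (by simp [hb])
    have hneg : ∀ l : Lit n, comp l (-1) = -1 := fun l => rfl
    have hs1 := sup_restr l M (Or.inl hl)
    have hs0 := sup_restr l.swap M (Or.inr (by simpa using hl))
    have hf1 := fat_restr T l M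
    have hf0 := fat_restr T l.swap M
    rw [Sum.swap_swap] at hf0
    have hM1 := K_restr M l hM
    have hM0 := K_restr M l.swap hM
    rw [hneg] at hM1 hM0
    refine combine (e := T + a) l hq hp hw hc ?_ ?_
    · refine ih a _ _ _ (fun j => comp_mem_V _ (hq j)) (fun j => comp_mem_V _ (hp j))
        (by omega) ?_ hM0
      have hsplit := Finset.card_filter_add_card_filter_not (s := fat T M) (fun A => l ∈ A)
      have hsplit' : (((fat T M).filter (fun A => l ∈ A)).card : ℝ) +
        ((fat T M).filter (fun A => l ∉ A)).card = (fat T M).card := by exact_mod_cast hsplit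
      have hf0' : ((fat T (restr l.swap M)).card : ℝ) ≤
        ((fat T M).filter (fun A => l ∉ A)).card := by exact_mod_cast hf0
      generalize ((T : ℝ) + 1) / (2 * (n + 1)) = x at *
      have hx : 1 - x ≤ Real.exp (-x) := by
        have := Real.add_one_le_exp (-x); linarith
      have e1 : Real.exp (x * a) = Real.exp (x * (a + 1 : ℕ)) * Real.exp (-x) := by
        rw [← Real.exp_add]; congr 1; push_cast; ring
      rw [e1]
      calc ((fat T (restr l.swap M)).card : ℝ) ≤ (1 - x) * (fat T M).card := by linarith
        _ ≤ Real.exp (-x) * (fat T M).card := by gcongr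
        _ < Real.exp (-x) * Real.exp (x * (a + 1 : ℕ)) := by gcongr
        _ = _ := mul_comm _ _
    · refine ih (a + 1) _ _ _ (fun j => comp_mem_V _ (hq j)) (fun j => comp_mem_V _ (hp j))
        (by omega) (lt_of_le_of_lt ?_ hb) hM1
      exact_mod_cast hf1.trans (Finset.card_filter_le _ _)

/-- Evaluation of polynomials on the cube. -/
def ev (n : ℕ) : MvPoly n →ₐ[ℝ] Fn n := aeval (fun l => lit l)

lemma ev_X {n : ℕ} (l : Lit n) : ev n (X l) = lit l := by simp [ev]

lemma ev_monomial {n : ℕ} (μ : Lit n →₀ ℕ) (a : ℝ) :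
    ev n (monomial μ a) = a • mono μ.support := by
  rw [ev, aeval_monomial, Algebra.smul_def, Finsupp.prod, mono]
  congr 1
  apply Finset.prod_congr rfl
  intro l hl
  have hne : μ l ≠ 0 := Finsupp.mem_support_iff.1 hl
  have h : IsIdempotentElem (lit l) := lit_mul_self l
  exact h.pow_eq hne

lemma ev_mem {n : ℕ} (r : MvPoly n) (U : Submodule ℝ (Fn n))
    (h : ∀ μ ∈ r.support, mono μ.support ∈ U) : ev n r ∈ U := by
  rw [r.as_sum, map_sum]
  refine sum_mem fun μ hμ => ?_
  rw [ev_monomial]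
  exact U.smul_mem _ (h μ hμ)

lemma ev_mem_V {n N : ℕ} (r : MvPoly n) (h : r.totalDegree ≤ N) : ev n r ∈ V n N := by
  apply ev_mem
  intro μ hμ
  apply mono_mem_V
  refine le_trans ?_ ((le_totalDegree hμ).trans h)
  rw [Finsupp.sum, Finset.card_eq_sum_ones]
  exact Finset.sum_le_sum fun i hi => Nat.one_le_iff_ne_zero.2 (Finsupp.mem_support_iff.1 hi)

lemma exists_lift {n N : ℕ} {f : Fn n} (hf : f ∈ V n N) :
    ∃ r : MvPoly n, r.totalDegree ≤ N ∧ ev n r = f := by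
  refine Submodule.span_induction (p := fun f _ => ∃ r : MvPoly n, r.totalDegree ≤ N ∧ ev n r = f)
    ?_ ?_ ?_ ?_ hf
  · rintro _ ⟨A, hA, rfl⟩
    refine ⟨∏ l ∈ A, X l, ?_, ?_⟩
    · refine (totalDegree_finset_prod _ _).trans ?_
      simpa using hA
    · simp [map_prod, ev_X, mono]
  · exact ⟨0, by simp, by simp⟩
  · rintro f g _ _ ⟨r, hr, rfl⟩ ⟨s, hs, rfl⟩
    exact ⟨r + s, (totalDegree_add _ _).trans (max_le hr hs), map_add _ _ _⟩
  · rintro a f _ ⟨r, hr, rfl⟩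
    exact ⟨a • r, (totalDegree_smul_le _ _).trans hr, map_smul _ _ _⟩

lemma ev_boolAxiom {n : ℕ} (a : Fin 3 × Fin n) : ev n (boolAxiom n a) = 0 := by
  unfold boolAxiom
  ext x
  split_ifs <;> simp [ev_X, lit] <;> split_ifs <;> simp

lemma ev_eq_zero {n : ℕ} (P : MvPoly n) (h : ev n P = 0) :
    ∃ u : Fin 3 × Fin n → MvPoly n, P = ∑ a, u a * boolAxiom n a := by
  set I : Ideal (MvPoly n) := Ideal.span (Set.range (boolAxiom n)) with hI
  suffices hP : P ∈ I by
    rw [hI, Ideal.mem_span_range_iff_exists_fun] at hP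
    obtain ⟨u, hu⟩ := hP
    exact ⟨u, hu.symm⟩
  have hax : ∀ a, boolAxiom n a ∈ I := fun a => Ideal.subset_span ⟨a, rfl⟩
  let red : MvPoly n →ₐ[ℝ] MvPolynomial (Fin n) ℝ :=
    aeval (Sum.elim (fun i => X i) (fun i => 1 - X i))
  let inc : MvPolynomial (Fin n) ℝ →ₐ[ℝ] MvPoly n := rename Sum.inl
  have h1 : ∀ P : MvPoly n, P - inc (red P) ∈ I := by
    intro P
    have : (Ideal.Quotient.mkₐ ℝ I) = ((Ideal.Quotient.mkₐ ℝ I).comp inc).comp red := by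
      apply MvPolynomial.algHom_ext
      rintro (i | i)
      · simp [red, inc]
      · simp only [red, inc, AlgHom.comp_apply, aeval_X, Sum.elim_inr, map_sub, map_one, rename_X]
        have := hax (2, i)
        rw [← Ideal.Quotient.eq_zero_iff_mem] at this
        simp only [boolAxiom, Fin.reduceEq, if_false, map_sub, map_add, map_one] at this
        simp only [Ideal.Quotient.mkₐ_eq_mk]
        linear_combination this
    have h2 := congrArg (fun φ => φ P) this
    simp only [AlgHom.comp_apply, Ideal.Quotient.mkₐ_eq_mk] at h2
    exact Ideal.Quotient.eq.1 h2
  have hred : ∀ (P : MvPoly n) (x : Fin n → Bool),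
      eval (fun i => lit (Sum.inl i) x) (red P) = ev n P x := by
    intro P x
    have : ((aeval (fun i => lit (Sum.inl i) x) : MvPolynomial (Fin n) ℝ →ₐ[ℝ] ℝ)).comp red =
        (Pi.evalAlgHom ℝ (fun _ : Fin n → Bool => ℝ) x).comp (ev n) := by
      apply MvPolynomial.algHom_ext
      rintro (i | i)
      · simp [red, ev_X]
      · simp [red, ev_X, lit]
        split_ifs <;> simp
    have h2 := congrArg (fun φ => φ P) this
    simpa [AlgHom.comp_apply, aeval_eq_eval] using h2
  obtain ⟨hh, -, hlin⟩ := combinatorial_nullstellensatz_exists_linearCombination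
    (fun _ : Fin n => ({0, 1} : Finset ℝ)) (fun _ => by simp) (red P) (by
      intro x hx
      have : x = fun i => lit (Sum.inl i) (fun i => decide (x i = 1)) := by
        ext i
        have := hx i
        simp at this
        rcases this with h | h <;> simp [lit, h]
      rw [this, hred, h]
      rfl)
  have h3 : inc (red P) ∈ I := by
    rw [hlin, Finsupp.linearCombination_apply, Finsupp.sum, map_sum]
    refine sum_mem fun i _ => ?_
    rw [smul_eq_mul, map_mul]
    apply Ideal.mul_mem_left
    have := hax (0, i)
    convert this using 1
    simp [boolAxiom, inc]
    ring
  have := add_mem (h1 P) h3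
  simpa using this

/-- The set of admissible products. -/
def allJ (ℓ w : ℕ) : Finset (Finset (Fin ℓ)) :=
  Finset.univ.filter (fun J => J.Nonempty ∧ J.card ≤ w)

lemma sosOf_append {n : ℕ} (a b : List (MvPoly n)) : sosOf (a ++ b) = sosOf a + sosOf b := by
  simp [sosOf]

lemma sosOf_deg {n N : ℕ} (a : List (MvPoly n)) (h : ∀ r ∈ a, r.totalDegree ≤ N) :
    (sosOf a).totalDegree ≤ 2 * N := by
  induction a with
  | nil => simp [sosOf]
  | cons r a ih =>
    have e : sosOf (r :: a) = r ^ 2 + sosOf a := by simp [sosOf]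
    rw [e]
    refine (totalDegree_add _ _).trans (max_le ?_ (ih fun s hs => h s (by simp [hs])))
    refine (totalDegree_pow _ _).trans ?_
    have := h r (by simp)
    omega

lemma extract {n ℓ m w c e : ℕ} (q : Fin ℓ → MvPoly n) (p : Fin m → MvPoly n) {f : Fn n}
    (hf : f ∈ KD (fun j => ev n (q j)) (fun j => ev n (p j)) w c e) :
    ∃ (r0 : List (MvPoly n)) (r : Finset (Fin ℓ) → List (MvPoly n)) (t : Fin m → MvPoly n),
      (∀ g ∈ r0, g.totalDegree ≤ e + c) ∧ (∀ J, ∀ g ∈ r J, g.totalDegree ≤ e) ∧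
      (∀ j, (t j).totalDegree ≤ 2 * e) ∧
      f = ev n (sosOf r0 + ∑ J ∈ allJ ℓ w, sosOf (r J) * ∏ j ∈ J, q j + ∑ j, t j * p j) := by
  refine K_ind (P := fun f => ∃ (r0 : List (MvPoly n)) (r : Finset (Fin ℓ) → List (MvPoly n))
      (t : Fin m → MvPoly n),
      (∀ g ∈ r0, g.totalDegree ≤ e + c) ∧ (∀ J, ∀ g ∈ r J, g.totalDegree ≤ e) ∧
      (∀ j, (t j).totalDegree ≤ 2 * e) ∧
      f = ev n (sosOf r0 + ∑ J ∈ allJ ℓ w, sosOf (r J) * ∏ j ∈ J, q j + ∑ j, t j * p j))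
    ?_ ?_ ?_ ?_ ?_ hf
  · exact ⟨[], fun _ => [], 0, by simp, by simp, by simp, by simp [sosOf]⟩
  · rintro f g ⟨r0, r, t, h0, h1, h2, rfl⟩ ⟨r0', r', t', h0', h1', h2', rfl⟩
    refine ⟨r0 ++ r0', fun J => r J ++ r' J, t + t', ?_, ?_, ?_, ?_⟩
    · intro g hg
      rcases List.mem_append.1 hg with h | h
      exacts [h0 g h, h0' g h]
    · intro J g hg
      rcases List.mem_append.1 hg with h | h
      exacts [h1 J g h, h1' J g h]
    · intro j
      exact (totalDegree_add _ _).trans (max_le (h2 j) (h2' j))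
    · rw [← map_add]
      congr 1
      simp only [sosOf_append, Pi.add_apply, add_mul, Finset.sum_add_distrib]
      ring
  · intro g hg
    obtain ⟨r, hr, rfl⟩ := exists_lift hg
    exact ⟨[r], fun _ => [], 0, by simpa using hr, by simp, by simp, by simp [sosOf, pow_two]⟩
  · intro g hg J hJ hJ'
    obtain ⟨r, hr, rfl⟩ := exists_lift hg
    refine ⟨[], fun J' => if J' = J then [r] else [], 0, by simp, ?_, by simp, ?_⟩
    · intro J' g hg
      dsimp only at hg
      split_ifs at hg
      · simp at hg
        rw [hg]; exact hr
      · simp at hg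
    · rw [Finset.sum_eq_single J]
      · simp [sosOf, pow_two]
      · intro J' _ hne
        simp [hne, sosOf]
      · intro hn
        exact absurd (Finset.mem_filter.2 ⟨Finset.mem_univ _, hJ', hJ⟩) hn
  · intro t ht j
    obtain ⟨r, hr, rfl⟩ := exists_lift ht
    refine ⟨[], fun _ => [], fun i => if i = j then r else 0, by simp, by simp, ?_, ?_⟩
    · intro i
      dsimp only
      split_ifs
      · exact hr
      · simp
    · simp [sosOf]

lemma to_proof {n ℓ m w k e : ℕ} (q : Fin ℓ → MvPoly n) (p : Fin m → MvPoly n)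
    (hq : ∀ j, (q j).totalDegree ≤ k) (hp : ∀ j, (p j).totalDegree ≤ k) (hw : 0 < w)
    (hf : (-1 : Fn n) ∈ KD (fun j => ev n (q j)) (fun j => ev n (p j)) w (k * w / 2 + 1) e) :
    ∃ π : PSProof n ℓ m q p (-1), π.widthLE w ∧ π.degreeLE (2 * e + k * w + 2) := by
  obtain ⟨r0, r, t, h0, h1, h2, h3⟩ := extract q p hf
  obtain ⟨u, hu⟩ := ev_eq_zero (-1 - (sosOf r0 + ∑ J ∈ allJ ℓ w, sosOf (r J) * ∏ j ∈ J, q j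
    + ∑ j, t j * p j)) (by rw [map_sub, ← h3]; simp)
  refine ⟨⟨allJ ℓ w, by simp [allJ], r0, r, t, u, ?_⟩, ?_, ?_, ?_, ?_, ?_⟩
  · rw [← hu]; ring
  · intro J hJ
    exact (Finset.mem_filter.1 hJ).2.2
  · simp
  · refine (sosOf_deg r0 h0).trans ?_
    omega
  · intro J hJ _
    have a1 := sosOf_deg (r J) (h1 J)
    have a2 : ∑ j ∈ J, (q j).totalDegree ≤ J.card • k := Finset.sum_le_card_nsmul _ _ _ fun j _ => hq j
    have a3 : J.card * k ≤ w * k := Nat.mul_le_mul_right _ (Finset.mem_filter.1 hJ).2.2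
    rw [smul_eq_mul] at a2
    rw [mul_comm w k] at a3
    change (sosOf (r J)).totalDegree + _ ≤ _
    omega
  · intro j _
    have a1 := h2 j
    have a2 := hp j
    have a3 : k * 1 ≤ k * w := Nat.mul_le_mul_left _ hw
    change (t j).totalDegree + _ ≤ _
    omega

/-- Reduced monomials of a polynomial. -/
def supp {n : ℕ} (r : MvPoly n) : Finset (Finset (Lit n)) := r.support.image Finsupp.support

/-- Reduced monomials of a list of polynomials. -/
def suppL {n : ℕ} (a : List (MvPoly n)) : Finset (Finset (Lit n)) :=
  a.foldr (fun r M => supp r ∪ M) ∅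

lemma suppL_card {n : ℕ} (a : List (MvPoly n)) :
    (suppL a).card ≤ (a.map fun r => r.support.card).sum := by
  induction a with
  | nil => simp [suppL]
  | cons r a ih =>
    have : suppL (r :: a) = supp r ∪ suppL a := rfl
    rw [this, List.map_cons, List.sum_cons]
    exact (Finset.card_union_le _ _).trans (add_le_add Finset.card_image_le ih)

lemma supp_subset_suppL {n : ℕ} {a : List (MvPoly n)} {r : MvPoly n} (h : r ∈ a) :
    supp r ⊆ suppL a := by
  induction a with
  | nil => simp at h
  | cons s a ih =>
    have e : suppL (s :: a) = supp s ∪ suppL a := rfl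
    rw [e]
    rcases List.mem_cons.1 h with rfl | h
    · exact Finset.subset_union_left
    · exact (ih h).trans Finset.subset_union_right

lemma ev_mem_SM {n : ℕ} {r : MvPoly n} {M : Finset (Finset (Lit n))} (h : supp r ⊆ M) :
    ev n r ∈ SM M :=
  ev_mem r _ fun μ hμ => Submodule.subset_span ⟨_, h (Finset.mem_image.2 ⟨μ, hμ, rfl⟩), rfl⟩

lemma ev_sosOf {n : ℕ} (a : List (MvPoly n)) :
    ev n (sosOf a) = (a.map fun r => ev n r * ev n r).sum := by
  rw [sosOf, map_list_sum, List.map_map]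
  congr 1
  apply List.map_congr_left
  intro r _
  simp [pow_two]

lemma of_proof {n ℓ m w : ℕ} {q : Fin ℓ → MvPoly n} {p : Fin m → MvPoly n}
    (π : PSProof n ℓ m q p (-1)) (hπ : π.widthLE w) :
    ∃ M : Finset (Finset (Lit n)), M.card ≤ π.size ∧
      (-1 : Fn n) ∈ K (fun j => ev n (q j)) (fun j => ev n (p j)) w (SM M) (SM M) (SM M) := by
  classical
  set M := (suppL π.r0 ∪ π.Js.biUnion fun J => suppL (π.r J)) ∪
    Finset.univ.biUnion fun j => supp (π.t j) with hM
  refine ⟨M, ?_, ?_⟩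
  · refine (Finset.card_union_le _ _).trans (add_le_add ((Finset.card_union_le _ _).trans
      (add_le_add (suppL_card _) ?_)) ?_)
    · exact Finset.card_biUnion_le.trans (Finset.sum_le_sum fun J _ => suppL_card _)
    · exact Finset.card_biUnion_le.trans (Finset.sum_le_sum fun j _ => Finset.card_image_le)
  · have hid := congrArg (ev n) π.identity
    simp only [map_neg, map_one, map_add, map_sum, map_mul, map_prod, ev_boolAxiom, mul_zero,
      Finset.sum_const_zero, add_zero] at hid
    rw [hid]
    refine add_mem (add_mem ?_ ?_) ?_
    · rw [ev_sosOf]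
      apply list_sum_mem
      intro f hf
      obtain ⟨r, hr, rfl⟩ := List.mem_map.1 hf
      refine K_sq (ev_mem_SM ((supp_subset_suppL hr).trans ?_))
      exact Finset.subset_union_left.trans Finset.subset_union_left
    · refine sum_mem fun J hJ => ?_
      rw [ev_sosOf, ← List.sum_map_mul_right]
      apply list_sum_mem
      intro f hf
      obtain ⟨r, hr, rfl⟩ := List.mem_map.1 hf
      refine K_q (q := fun j => ev n (q j)) (ev_mem_SM ((supp_subset_suppL hr).trans ?_))
        (hπ J hJ) ?_
      · refine (Finset.subset_biUnion_of_mem (fun J => suppL (π.r J)) hJ).trans ?_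
        exact Finset.subset_union_right.trans Finset.subset_union_left
      · rw [Finset.nonempty_iff_ne_empty]
        rintro rfl
        exact π.empty_not_mem hJ
    · refine sum_mem fun j _ => ?_
      refine K_p (p := fun j => ev n (p j)) (ev_mem_SM ?_) j
      exact (Finset.subset_biUnion_of_mem (fun j => supp (π.t j)) (Finset.mem_univ j)).trans
        Finset.subset_union_right

end PSAux

/-- **Corollary (degree criterion for size lower bounds).** If `d` is the minimum
degree and `s` the minimum monomial size of PS refutations from `Q` of product-width
at most `w` (such refutations existing), and `d ≥ k·w + 4`, then
`s ≥ exp((d − k·w − 4)² / (32(n+1)))`. -/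
theorem statement1 (n k ℓ m : ℕ) (q : Fin ℓ → MvPoly n) (p : Fin m → MvPoly n)
    (hq : ∀ j, (q j).totalDegree ≤ k) (hp : ∀ j, (p j).totalDegree ≤ k)
    (w : ℕ) (hw : 0 < w)
    (hrefut : ∃ π : PSProof n ℓ m q p (-1), π.widthLE w)
    (d s : ℕ)
    (hd : d = sInf {d' : ℕ | ∃ π : PSProof n ℓ m q p (-1), π.widthLE w ∧ π.degreeLE d'})
    (hs : s = sInf {s' : ℕ | ∃ π : PSProof n ℓ m q p (-1), π.widthLE w ∧ π.size ≤ s'})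
    (hdk : k * w + 4 ≤ d) :
    Real.exp (((d : ℝ) - k * w - 4) ^ 2 / (32 * (n + 1))) ≤ (s : ℝ) := by
  have hne : {s' : ℕ | ∃ π : PSProof n ℓ m q p (-1), π.widthLE w ∧ π.size ≤ s'}.Nonempty := by
    obtain ⟨π, hπ⟩ := hrefut
    exact ⟨π.size, π, hπ, le_rfl⟩
  have hmem := Nat.sInf_mem hne
  rw [← hs] at hmem
  obtain ⟨π, hπw, hπs⟩ := hmem
  obtain ⟨M, hMs, hM⟩ := PSAux.of_proof π hπw
  have hMs' : M.card ≤ s := hMs.trans hπs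
  have key : ∀ T a : ℕ, (s : ℝ) < Real.exp (((T : ℝ) + 1) / (2 * (n + 1)) * a) →
      d ≤ 2 * (T + a) + k * w + 2 := by
    intro T a hTa
    have hfat : ((PSAux.fat T M).card : ℝ) ≤ s := by
      exact_mod_cast (Finset.card_filter_le _ _).trans hMs'
    have h1 := PSAux.main_induction (c := k * w / 2 + 1) hw (by omega) (M.sup id).card a _ _ M
      (fun j => PSAux.ev_mem_V (q j) (hq j)) (fun j => PSAux.ev_mem_V (p j) (hp j)) le_rfl
      (hfat.trans_lt hTa) hM
    rw [hd]
    exact Nat.sInf_le (PSAux.to_proof q p hq hp hw h1)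
  rcases Nat.eq_zero_or_pos s with hs0 | hs0
  · have := key 0 0 (by simp [hs0])
    omega
  have hs1 : (1 : ℝ) ≤ s := by exact_mod_cast hs0
  have hlog : 0 ≤ Real.log s := Real.log_nonneg hs1
  set Y : ℝ := 2 * (n + 1) * Real.log s with hY
  have hY0 : 0 ≤ Y := by positivity
  set N : ℕ := ⌊Real.sqrt Y⌋₊ with hN
  have hN1 : (N : ℝ) ≤ Real.sqrt Y := Nat.floor_le (Real.sqrt_nonneg _)
  have hN2 : Real.sqrt Y < N + 1 := Nat.lt_floor_add_one _
  have hsq : Real.sqrt Y ^ 2 = Y := Real.sq_sqrt hY0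
  have hd' := key N (N + 1) (by
    rw [← Real.log_lt_iff_lt_exp (by linarith)]
    have h2 : Y < (N + 1) ^ 2 := by
      rw [← hsq]
      exact pow_lt_pow_left₀ hN2 (Real.sqrt_nonneg _) (by norm_num)
    push_cast
    rw [div_mul_eq_mul_div, lt_div_iff₀ (by positivity)]
    nlinarith)
  have hd2 : (d : ℝ) ≤ 2 * (N + (N + 1)) + k * w + 2 := by exact_mod_cast hd'
  have hdk' : (k : ℝ) * w + 4 ≤ d := by exact_mod_cast hdk
  rw [← Real.le_log_iff_exp_le (by linarith), div_le_iff₀ (by positivity)]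
  have h3 : ((d : ℝ) - k * w - 4) ^ 2 ≤ (4 * Real.sqrt Y) ^ 2 :=
    pow_le_pow_left₀ (by linarith) (by linarith) 2
  rw [mul_pow, hsq, hY] at h3
  linarith
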